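/- Let P be a simple polytope such that all minimal nonfaces of K(P) have cardinality 4 and are pairwise disjoint, and K(P) is a simplicial sphere. Then K(P) = ∂Δ³ ⋆ ⋯ ⋆ ∂Δ³ (n-fold join) for some n, and hence P = (Δ³)ⁿ. -/

import Mathlib

open ContinuousMap

/-! ### Polytopes, faces, and the dual boundary complex K(P) -/

/-- `F` is a face of the convex set `P` (in a real vector space): the
intersection of `P` with a supporting hyperplane, or `P` itself, or `∅`. -/
def IsFaceOf {E : Type*} [AddCommGroup E] [Module ℝ E] (P F : Set E) : Prop :=
  ∃ (f : E →ₗ[ℝ] ℝ) (c : ℝ), (∀ x ∈ P, f x ≤ c) ∧ F = {x ∈ P | f x = c}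

/-- A facet of a full-dimensional polytope `P ⊆ ℝⁿ`: a face of affine
dimension `n - 1`. -/
def IsFacetOf {n : ℕ} (P F : Set (Fin n → ℝ)) : Prop :=
  IsFaceOf P F ∧ F.Nonempty ∧
    Module.finrank ℝ (affineSpan ℝ F).direction = n - 1

/-- A vertex of `P`: a point whose singleton is a face. -/
def IsVertexOf {E : Type*} [AddCommGroup E] [Module ℝ E] (P : Set E) (v : E) :
    Prop :=
  IsFaceOf P {v}

/-- `P ⊆ ℝⁿ` is an `n`-dimensional simple polytope: a full-dimensional
convex polytope each of whose vertices lies on exactly `n` facets. -/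
def IsSimplePolytope (n : ℕ) (P : Set (Fin n → ℝ)) : Prop :=
  (∃ S : Finset (Fin n → ℝ), P = convexHull ℝ ↑S) ∧
    (interior P).Nonempty ∧
    ∀ v, IsVertexOf P v → {F | IsFacetOf P F ∧ v ∈ F}.ncard = n

/-- The boundary complex `K(P)` of the dual simplicial polytope of `P`, as an
abstract simplicial complex on the set `Fin m` enumerating the facets of `P`
(via `e`): a set `σ` of facets is a face of `K(P)` iff the facets in `σ` have
a common point. -/
def dualComplex {n m : ℕ} (P : Set (Fin n → ℝ))
    (e : Fin m ≃ {F : Set (Fin n → ℝ) // IsFacetOf P F}) :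
    Set (Finset (Fin m)) :=
  {σ | (⋂ i ∈ σ, ((e i : {F : Set (Fin n → ℝ) // IsFacetOf P F}) :
    Set (Fin n → ℝ))).Nonempty}

/-! ### Moment-angle complexes, characteristic matrices and
quasitoric manifolds M(A) = Z_{K(P)}/T(A) -/

/-- The moment-angle complex Z_K ⊆ (D²)^V of a simplicial complex `K` on `V`. -/
def momentAngle {V : Type*} (K : Set (Finset V)) : Set (V → ℂ) :=
  {z | (∀ i, ‖z i‖ ≤ 1) ∧ ∃ σ ∈ K, ∀ i, i ∉ σ → ‖z i‖ = 1}

/-- `A` is a characteristic matrix over `P` (with facets enumerated by `e`):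
an `n × m` integer matrix whose columns indexed by any `n` facets meeting at a
point form a matrix of determinant ±1. -/
def IsCharMatrix {n m : ℕ} (P : Set (Fin n → ℝ))
    (e : Fin m ≃ {F : Set (Fin n → ℝ) // IsFacetOf P F})
    (A : Matrix (Fin n) (Fin m) ℤ) : Prop :=
  ∀ σ ∈ dualComplex P e, ∀ hc : σ.card = n,
    IsUnit (Matrix.det (Matrix.of fun r c : Fin n =>
      A r ((σ.orderIsoOfFin hc c : σ) : Fin m)))

/-- The quasitoric manifold `M(A) = Z_K / T(A)`, where the subtorus
`T(A) = {t ∈ T^V | ∏ᵢ tᵢ^{A_{j i}} = 1 for all j}` of `T^V` acts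
coordinatewise on `Z_K ⊆ ℂ^V`; given as the quotient of `Z_K` identifying
points in the same `T(A)`-orbit. -/
def MA {V R : Type*} [Fintype V] (K : Set (Finset V)) (A : R → V → ℤ) : Type _ :=
  Quot (fun z w : momentAngle K => ∃ t : V → Circle,
    (∀ j, ∏ i, t i ^ A j i = 1) ∧
    ∀ i, (w : V → ℂ) i = (t i : ℂ) * (z : V → ℂ) i)

/-- The (based) loop space of `X` at `x`. -/
def Loop (X : Type*) [TopologicalSpace X] (x : X) : Type _ :=
  {γ : C(unitInterval, X) // γ 0 = x ∧ γ 1 = x}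

instance {X : Type*} [TopologicalSpace X] (x : X) :
    TopologicalSpace (Loop X x) :=
  instTopologicalSpaceSubtype

/-- The basepoint `(1,…,1)` of a moment-angle complex. -/
def maOne {V : Type*} (K : Set (Finset V)) (h : ∅ ∈ K) : momentAngle K :=
  ⟨fun _ => 1, fun i => by simp, ∅, h, fun i _ => by simp⟩

lemma dualComplex_empty_mem {n m : ℕ} (P : Set (Fin n → ℝ))
    (e : Fin m ≃ {F : Set (Fin n → ℝ) // IsFacetOf P F}) :
    ∅ ∈ dualComplex P e := by
  simp [dualComplex, Set.univ_nonempty]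

instance {V R : Type*} [Fintype V] (K : Set (Finset V)) (A : R → V → ℤ) :
    TopologicalSpace (MA K A) :=
  inferInstanceAs (TopologicalSpace (Quot _))

/-- A minimal nonface of a simplicial complex `K`: a vertex set that is not a
face but all of whose proper subsets are faces. -/
def IsMinimalNonface {V : Type*} (K : Set (Finset V)) (I : Finset V) : Prop :=
  I ∉ K ∧ ∀ τ ⊂ I, τ ∈ K

/-- The geometric realization of a simplicial complex `K` on a finite vertex
set `V`, inside the standard simplex of ℝ^V. -/
def realization {V : Type*} [Fintype V] (K : Set (Finset V)) :
    Set (V → ℝ) :=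
  {x | (∀ v, 0 ≤ x v) ∧ (∑ v, x v) = 1 ∧ ∃ σ ∈ K, ∀ v, x v ≠ 0 → v ∈ σ}

/-- The polytope `(Δ³)^N`: the `N`-fold product of standard 3-simplices, in
`ℝ^{Fin N × Fin 4}`. -/
def prodDelta3 (N : ℕ) : Set (Fin N × Fin 4 → ℝ) :=
  {x | (∀ p, 0 ≤ x p) ∧ ∀ i : Fin N, (∑ j : Fin 4, x (i, j)) = 1}


/-- small perturbation lemma -/
lemma s17_eps {ι : Type*} [Finite ι] (a b : ι → ℝ) (h : ∀ i, a i < 0 ∨ (a i ≤ 0 ∧ b i ≤ 0)) :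
    ∃ ε : ℝ, 0 < ε ∧ ∀ i, a i + ε * b i ≤ 0 := by
  have key : ∀ᶠ ε : ℝ in nhdsWithin 0 (Set.Ioi 0), ∀ i, a i + ε * b i ≤ 0 := by
    rw [Filter.eventually_all]
    intro i
    rcases h i with h | ⟨h1, h2⟩
    · have : Filter.Tendsto (fun ε : ℝ => a i + ε * b i) (nhdsWithin 0 (Set.Ioi 0))
          (nhds (a i + 0 * b i)) := by
        apply Filter.Tendsto.mono_left _ nhdsWithin_le_nhds
        exact (Continuous.tendsto (by fun_prop) 0)
      rw [zero_mul, add_zero] at this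
      exact (this.eventually_lt_const h).mono fun _ h => h.le
    · filter_upwards [self_mem_nhdsWithin] with ε hε
      have : ε * b i ≤ 0 := mul_nonpos_of_nonneg_of_nonpos (le_of_lt hε) h2
      linarith
  obtain ⟨ε, h1, h2⟩ := (key.and self_mem_nhdsWithin).exists
  exact ⟨ε, h2, h1⟩

/-- inequality representation, with local extension property -/
structure S17Rep {ι E : Type*} [AddCommGroup E] [Module ℝ E] (P : Set E)
    (f : ι → E →ₗ[ℝ] ℝ) (c : ι → ℝ) : Prop where
  convex : Convex ℝ P
  le : ∀ i, ∀ x ∈ P, f i x ≤ c i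
  ext : ∀ x ∈ P, ∀ y ∈ P, (∀ i, f i x = c i → f i y = c i) →
    ∃ ε : ℝ, 0 < ε ∧ x + ε • (x - y) ∈ P

/-- the face cut out by a set of indices -/
def s17Face {ι E : Type*} [AddCommGroup E] [Module ℝ E] (P : Set E)
    (f : ι → E →ₗ[ℝ] ℝ) (c : ι → ℝ) (σ : Finset ι) : Set E :=
  {x ∈ P | ∀ i ∈ σ, f i x = c i}

section
variable {ι E : Type*} [AddCommGroup E] [Module ℝ E] {P : Set E}
  {f : ι → E →ₗ[ℝ] ℝ} {c : ι → ℝ}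

lemma s17Face_isFace (h : S17Rep P f c) (σ : Finset ι) : IsFaceOf P (s17Face P f c σ) := by
  refine ⟨∑ i ∈ σ, f i, ∑ i ∈ σ, c i, ?_, ?_⟩
  · intro x hx
    rw [LinearMap.sum_apply]
    exact Finset.sum_le_sum fun i _ => h.le i x hx
  · ext x
    simp only [s17Face, Set.mem_ofPred_eq, LinearMap.sum_apply]
    refine and_congr_right fun hx => ?_
    rw [Finset.sum_eq_sum_iff_of_le fun i _ => h.le i x hx]

lemma s17_exists_face [Fintype ι] (h : S17Rep P f c) (G : Set E) (hG : IsFaceOf P G)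
    (hne : G.Nonempty) : ∃ σ, G = s17Face P f c σ := by
  classical
  obtain ⟨g, d, hg, rfl⟩ := hG
  set G := {x ∈ P | g x = d}
  let φ : E → Finset ι := fun x => Finset.univ.filter fun i => f i x = c i
  obtain ⟨x, hx, hmin⟩ : ∃ x ∈ G, ∀ y ∈ G, (φ x).card ≤ (φ y).card := by
    obtain ⟨x, hx, hm⟩ := WellFounded.has_min
      (InvImage.wf (fun x => (φ x).card) Nat.lt_wfRel.wf) G hne
    exact ⟨x, hx, fun y hy => not_lt.mp (hm y hy)⟩
  refine ⟨φ x, Set.Subset.antisymm ?_ ?_⟩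
  · intro y hy
    refine ⟨hy.1, ?_⟩
    let z := (1/2 : ℝ) • x + (1/2 : ℝ) • y
    have hz : z ∈ G := by
      refine ⟨h.convex hx.1 hy.1 (by norm_num) (by norm_num) (by norm_num), ?_⟩
      simp only [z, map_add, map_smul, hx.2, hy.2, smul_eq_mul]
      ring
    have hiff : ∀ i, i ∈ φ z → i ∈ φ x ∧ i ∈ φ y := by
      intro i hi
      simp only [φ, Finset.mem_filter, Finset.mem_univ, true_and, z, map_add, map_smul,
        smul_eq_mul] at hi ⊢
      have h1 := h.le i x hx.1
      have h2 := h.le i y hy.1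
      constructor <;> linarith
    have : φ z = φ x := Finset.eq_of_subset_of_card_le (fun i hi => (hiff i hi).1) (hmin z hz)
    intro i hi
    rw [← this] at hi
    have := (hiff i hi).2
    simpa [φ] using this
  · rintro y ⟨hy, hy2⟩
    obtain ⟨ε, he, hm⟩ := h.ext x hx.1 y hy (fun i hi => hy2 i (by simpa [φ] using hi))
    refine ⟨hy, ?_⟩
    have h1 := hg _ hm
    have h2 := hg _ hy
    simp only [map_add, map_smul, map_sub, hx.2, smul_eq_mul] at h1
    have h3 : ε * (d - g y) ≤ 0 := by linarith
    have h4 : d - g y ≤ 0 := by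
      by_contra hh
      push Not at hh
      have := mul_pos he hh
      linarith
    linarith

/-- faces of `P` are classified by the complex of index sets -/
lemma s17_orderIso [Fintype ι] [DecidableEq ι] (h : S17Rep P f c)
    (K : Set (Finset ι)) (hK : ∀ σ, σ ∈ K ↔ (s17Face P f c σ).Nonempty)
    (huniv : Finset.univ ∉ K)
    (hinj : ∀ σ ∈ K, ∀ j ∉ σ, ∃ x ∈ s17Face P f c σ, f j x ≠ c j) :
    Nonempty ({F : Set E // IsFaceOf P F} ≃o {σ : Finset ι // σ ∈ K ∨ σ = Finset.univ}ᵒᵈ) := by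
  classical
  let φ : Set E → Finset ι := fun G => Finset.univ.filter fun i => ∀ x ∈ G, f i x = c i
  have hφ : ∀ G i, i ∈ φ G ↔ ∀ x ∈ G, f i x = c i := by intro G i; simp [φ]
  have hGP : ∀ G, IsFaceOf P G → G ⊆ P := by
    rintro G ⟨g, d, -, rfl⟩ x hx
    exact hx.1
  have hsub : ∀ G, IsFaceOf P G → G ⊆ s17Face P f c (φ G) := fun G hG x hx =>
    ⟨hGP G hG hx, fun i hi => (hφ G i).1 hi x hx⟩
  have hmem : ∀ G, IsFaceOf P G → (φ G ∈ K ∨ φ G = Finset.univ) := by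
    intro G hG
    rcases G.eq_empty_or_nonempty with rfl | hne
    · right; ext i; simp [hφ]
    · left
      rw [hK]
      exact hne.mono (hsub G hG)
  have hle : ∀ G G', IsFaceOf P G → IsFaceOf P G' → (φ G' ⊆ φ G ↔ G ⊆ G') := by
    intro G G' hG hG'
    constructor
    · intro hs
      rcases G.eq_empty_or_nonempty with rfl | hne
      · exact Set.empty_subset _
      rcases G'.eq_empty_or_nonempty with rfl | hne'
      · exfalso
        have : φ G = Finset.univ := by
          apply Finset.univ_subset_iff.1
          refine subset_trans ?_ hs
          intro i _
          simp [hφ]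
        apply huniv
        rw [← this, hK]
        exact hne.mono (hsub G hG)
      · obtain ⟨τ, hτ⟩ := s17_exists_face h G' hG' hne'
        have hτ' : τ ⊆ φ G' := by
          intro i hi
          rw [hφ, hτ]
          exact fun x hx => hx.2 i hi
        intro x hx
        rw [hτ]
        exact ⟨hGP G hG hx, fun i hi => (hφ G i).1 (hs (hτ' hi)) x hx⟩
    · intro hs i hi
      rw [hφ] at hi ⊢
      exact fun x hx => hi x (hs hx)
  let g : {F : Set E // IsFaceOf P F} ↪o {σ : Finset ι // σ ∈ K ∨ σ = Finset.univ}ᵒᵈ :=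
    OrderEmbedding.ofMapLEIff (fun G => OrderDual.toDual ⟨φ G.1, hmem G.1 G.2⟩)
      (fun G G' => hle G.1 G'.1 G.2 G'.2)
  refine ⟨RelIso.ofSurjective g ?_⟩
  rintro ⟨σ, hσ⟩
  rcases hσ with hσ | rfl
  · refine ⟨⟨s17Face P f c σ, s17Face_isFace h σ⟩, ?_⟩
    have : φ (s17Face P f c σ) = σ := by
      ext j
      rw [hφ]
      constructor
      · intro hj
        by_contra hn
        obtain ⟨x, hx, hx'⟩ := hinj σ hσ j hn
        exact hx' (hj x hx)
      · exact fun hj x hx => hx.2 j hj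
    exact Subtype.ext this
  · refine ⟨⟨∅, 0, 1, by simp, by simp⟩, ?_⟩
    have : φ ∅ = Finset.univ := by ext i; simp [hφ]
    exact Subtype.ext this

end

/-- the representation of the product of simplices -/
lemma s17_prod_rep (N : ℕ) : S17Rep (prodDelta3 N)
    (fun p : Fin N × Fin 4 => -(LinearMap.proj p : (Fin N × Fin 4 → ℝ) →ₗ[ℝ] ℝ))
    (fun _ => 0) where
  convex := by
    intro x hx y hy a b ha hb hab
    refine ⟨fun p => ?_, fun i => ?_⟩
    · have := mul_nonneg ha (hx.1 p)
      have := mul_nonneg hb (hy.1 p)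
      simp only [Pi.add_apply, Pi.smul_apply, smul_eq_mul]
      linarith
    · simp only [Pi.add_apply, Pi.smul_apply, smul_eq_mul, Finset.sum_add_distrib,
        ← Finset.mul_sum, hx.2 i, hy.2 i]
      linarith
  le := by
    intro p x hx
    simpa using hx.1 p
  ext := by
    intro x hx y hy h
    obtain ⟨ε, he, h2⟩ := s17_eps (fun p => - x p) (fun p => - (x p - y p)) (by
      intro p
      rcases (hx.1 p).lt_or_eq with h1 | h1
      · left; linarith
      · right
        have := h p (by simp [← h1])
        simp at this
        simp [← h1, this])
    refine ⟨ε, he, fun p => ?_, fun i => ?_⟩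
    · have := h2 p
      simp only [Pi.add_apply, Pi.smul_apply, smul_eq_mul, Pi.sub_apply]
      linarith
    · simp only [Pi.add_apply, Pi.smul_apply, smul_eq_mul, Pi.sub_apply, Finset.sum_add_distrib,
        ← Finset.mul_sum, Finset.sum_sub_distrib, hx.2 i, hy.2 i]
      linarith

lemma s17_prod_iso (N : ℕ) (hN : 0 < N) (K : Set (Finset (Fin N × Fin 4)))
    (hK : ∀ σ, σ ∈ K ↔ ∀ i : Fin N, ∃ j : Fin 4, (i, j) ∉ σ) :
    Nonempty ({F : Set (Fin N × Fin 4 → ℝ) // IsFaceOf (prodDelta3 N) F} ≃o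
      {σ : Finset (Fin N × Fin 4) // σ ∈ K ∨ σ = Finset.univ}ᵒᵈ) := by
  have key : ∀ s : Fin N → Fin 4,
      (fun p : Fin N × Fin 4 => if p.2 = s p.1 then (1:ℝ) else 0) ∈ prodDelta3 N := by
    intro s
    refine ⟨fun p => ?_, fun i => ?_⟩
    · dsimp only; split_ifs <;> norm_num
    · simp
  apply s17_orderIso (s17_prod_rep N) K
  · intro σ
    rw [hK]
    constructor
    · intro h
      choose s hs using h
      refine ⟨_, key s, ?_⟩
      rintro ⟨i, j⟩ hp
      have : j ≠ s i := by rintro rfl; exact hs i hp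
      simp [this]
    · rintro ⟨x, hx, hx2⟩ i
      by_contra hn
      push Not at hn
      have := hx.2 i
      rw [Finset.sum_eq_zero] at this
      · norm_num at this
      · intro j _
        simpa using hx2 (i, j) (hn j)
  · rw [hK]
    intro h
    obtain ⟨j, hj⟩ := h ⟨0, hN⟩
    simp at hj
  · intro σ hσ p hp
    rw [hK] at hσ
    choose s hs using hσ
    obtain ⟨i₀, j₀⟩ := p
    have hs' : ∀ i, (i, Function.update s i₀ j₀ i) ∉ σ := by
      intro i
      by_cases h : i = i₀
      · subst h; simpa using hp
      · simpa [Function.update_of_ne h] using hs i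
    refine ⟨_, ⟨key (Function.update s i₀ j₀), ?_⟩, ?_⟩
    · rintro ⟨i, j⟩ hp
      have : j ≠ Function.update s i₀ j₀ i := by rintro rfl; exact hs' i hp
      simp [this]
    · simp

/-- every point outside a polytope violates a facet inequality -/
lemma s17_violated {n : ℕ} (S : Finset (Fin n → ℝ)) (x₀ x : Fin n → ℝ)
    (h₀ : x₀ ∈ interior (convexHull ℝ (S : Set (Fin n → ℝ))))
    (hx : x ∉ convexHull ℝ (S : Set (Fin n → ℝ))) :
    ∃ g : (Fin n → ℝ) →L[ℝ] ℝ, (∀ y ∈ convexHull ℝ (S : Set (Fin n → ℝ)), g (y - x₀) ≤ 1) ∧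
      1 < g (x - x₀) ∧
      Submodule.span ℝ ((fun y => y - x₀) ''
        {y ∈ convexHull ℝ (S : Set (Fin n → ℝ)) | g (y - x₀) = 1}) = ⊤ := by
  classical
  set P := convexHull ℝ (S : Set (Fin n → ℝ)) with hPdef
  let Q : Set ((Fin n → ℝ) →L[ℝ] ℝ) := {g | ∀ y ∈ P, g (y - x₀) ≤ 1}
  have hQS : ∀ g : (Fin n → ℝ) →L[ℝ] ℝ, (∀ s ∈ S, g (s - x₀) ≤ 1) → g ∈ Q := by
    intro g hg y hy
    have hc : Convex ℝ {y | g (y - x₀) ≤ 1} := by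
      have : {y | g (y - x₀) ≤ 1} = {y | g y ≤ 1 + g x₀} := by
        ext y; simp [map_sub]
      rw [this]
      exact convex_halfSpace_le g.toLinearMap.isLinear _
    exact convexHull_min (fun s hs => hg s hs) hc hy
  have hPclosed : IsClosed P := (S.finite_toSet.isCompact_convexHull ℝ).isClosed
  have hQclosed : IsClosed Q := by
    have : Q = ⋂ y ∈ P, {g : (Fin n → ℝ) →L[ℝ] ℝ | g (y - x₀) ≤ 1} := by
      ext g; simp [Q]
    rw [this]
    refine isClosed_biInter fun y _ => isClosed_le ?_ continuous_const
    exact (ContinuousLinearMap.apply ℝ ℝ (y - x₀)).continuous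
  obtain ⟨r, hr, hball⟩ := Metric.mem_nhds_iff.1 (mem_interior_iff_mem_nhds.1 h₀)
  have hQbdd : Q ⊆ Metric.closedBall 0 (2 / r) := by
    intro g hg
    rw [mem_closedBall_zero_iff]
    have key : ∀ z : Fin n → ℝ, ‖z‖ < r → ‖g z‖ ≤ 1 := by
      intro z hz
      have h1 := hg (x₀ + z) (hball (by simpa using hz))
      have h2 := hg (x₀ - z) (hball (by simpa using hz))
      simp at h1 h2
      rw [Real.norm_eq_abs, abs_le]
      constructor <;> linarith
    refine ContinuousLinearMap.opNorm_le_bound _ (by positivity) fun z => ?_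
    by_cases hz : z = 0
    · simp [hz]
    have hz' : 0 < ‖z‖ := norm_pos_iff.2 hz
    have := key ((r / (2 * ‖z‖)) • z) (by
      rw [norm_smul, Real.norm_of_nonneg (by positivity)]
      field_simp
      linarith)
    rw [map_smul, norm_smul, Real.norm_of_nonneg (by positivity)] at this
    rw [div_mul_eq_mul_div, div_le_one (by positivity)] at this
    rw [div_mul_eq_mul_div, le_div_iff₀ hr]
    linarith
  have hprop : ProperSpace ((Fin n → ℝ) →L[ℝ] ℝ) := FiniteDimensional.proper_real _
  have hQc : IsCompact Q := (isCompact_closedBall _ _).of_isClosed_subset hQclosed hQbdd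
  obtain ⟨g₀, hg₀, hg₀x⟩ : ∃ g ∈ Q, 1 < g (x - x₀) := by
    obtain ⟨g, u, h1, h2⟩ := geometric_hahn_banach_closed_point (convex_convexHull ℝ _) hPclosed hx
    have hu : 0 < u - g x₀ := sub_pos.2 (h1 x₀ (interior_subset h₀))
    refine ⟨(u - g x₀)⁻¹ • g, fun y hy => ?_, ?_⟩
    · simp only [_root_.smul_apply, map_sub, smul_eq_mul, ← mul_sub]
      rw [inv_mul_le_iff₀ hu]
      linarith [h1 y hy]
    · simp only [_root_.smul_apply, map_sub, smul_eq_mul, ← mul_sub]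
      rw [lt_inv_mul_iff₀ hu]
      linarith
  have hevc : Continuous fun g : (Fin n → ℝ) →L[ℝ] ℝ => g (x - x₀) :=
    (ContinuousLinearMap.apply ℝ ℝ (x - x₀)).continuous
  obtain ⟨g₁, hg₁, hmax⟩ := hQc.exists_isMaxOn ⟨g₀, hg₀⟩ hevc.continuousOn
  let M : Set ((Fin n → ℝ) →L[ℝ] ℝ) := {g ∈ Q | g (x - x₀) = g₁ (x - x₀)}
  have hMc : IsCompact M := hQc.inter_right (isClosed_eq hevc continuous_const)
  obtain ⟨g, hg⟩ := hMc.extremePoints_nonempty ⟨g₁, hg₁, rfl⟩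
  have hgM : g ∈ M := extremePoints_subset hg
  refine ⟨g, hgM.1, ?_, ?_⟩
  · rw [hgM.2]
    exact lt_of_lt_of_le hg₀x (hmax hg₀)
  by_contra hspan
  obtain ⟨w, hw0, hw⟩ := Submodule.exists_le_ker_of_lt_top _ (lt_top_iff_ne_top.2 hspan)
  let w' : (Fin n → ℝ) →L[ℝ] ℝ := LinearMap.toContinuousLinearMap w
  have hw'0 : w' ≠ 0 := by
    intro h
    apply hw0
    ext1 i
    have := congrArg (fun q : (Fin n → ℝ) →L[ℝ] ℝ => q.toLinearMap) h
    simpa [w'] using congrArg (fun q => q.comp (LinearMap.single ℝ (fun _ => ℝ) i)) this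
  have hwv : ∀ s ∈ S, g (s - x₀) = 1 → w (s - x₀) = 0 := by
    intro s hs h
    have : s - x₀ ∈ LinearMap.ker w := hw (Submodule.subset_span
      ⟨s, ⟨subset_convexHull ℝ _ hs, h⟩, rfl⟩)
    simpa using this
  have hgs : ∀ s ∈ S, g (s - x₀) ≤ 1 := fun s hs => hgM.1 s (subset_convexHull ℝ _ hs)
  obtain ⟨ε, he, hε⟩ := s17_eps (ι := S × Bool) (fun p => g (p.1.1 - x₀) - 1)
    (fun p => (if p.2 then 1 else -1) * w (p.1.1 - x₀)) (by
      rintro ⟨⟨s, hs⟩, b⟩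
      rcases (hgs s hs).lt_or_eq with h | h
      · left; simpa using h
      · right; simp [h, hwv s hs h])
  have hp : g + ε • w' ∈ Q := by
    apply hQS
    intro s hs
    have := hε (⟨s, hs⟩, true)
    simp [w'] at this ⊢
    linarith
  have hm : g - ε • w' ∈ Q := by
    apply hQS
    intro s hs
    have := hε (⟨s, hs⟩, false)
    simp [w'] at this ⊢
    linarith
  have h1 := hmax hp
  have h2 := hmax hm
  have h3 := hgM.2
  simp only [Set.mem_ofPred_eq, _root_.add_apply, _root_.sub_apply] at h1 h2
  have hp' : g + ε • w' ∈ M := ⟨hp, by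
    simp only [_root_.add_apply]; linarith⟩
  have hm' : g - ε • w' ∈ M := ⟨hm, by
    simp only [_root_.sub_apply]; linarith⟩
  have := (mem_extremePoints.1 hg).2 _ hp' _ hm' ⟨1/2, 1/2, by norm_num, by norm_num, by norm_num, by
    module⟩
  have h4 : ε • w' = 0 := by simpa using this.1
  rcases smul_eq_zero.1 h4 with h | h
  · exact he.ne' h
  · exact hw'0 h

/-- the set cut out in `s17_violated` is a facet -/
lemma s17_facet {n : ℕ} (hn : 0 < n) (P : Set (Fin n → ℝ)) (x₀ : Fin n → ℝ)
    (g : (Fin n → ℝ) →L[ℝ] ℝ) (hg : ∀ y ∈ P, g (y - x₀) ≤ 1)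
    (hspan : Submodule.span ℝ ((fun y => y - x₀) '' {y ∈ P | g (y - x₀) = 1}) = ⊤) :
    IsFacetOf P {y ∈ P | g (y - x₀) = 1} := by
  set T := {y ∈ P | g (y - x₀) = 1} with hT
  have hne : T.Nonempty := by
    rw [Set.nonempty_iff_ne_empty]
    intro h
    rw [h, Set.image_empty, Submodule.span_empty] at hspan
    have := congrArg (fun W : Submodule ℝ (Fin n → ℝ) => Module.finrank ℝ W) hspan
    simp at this
    omega
  refine ⟨⟨g.toLinearMap, 1 + g x₀, ?_, ?_⟩, hne, ?_⟩
  · intro y hy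
    have := hg y hy
    rw [map_sub] at this
    simp; linarith
  · ext y
    simp only [hT, Set.mem_ofPred_eq, map_sub, ContinuousLinearMap.coe_coe]
    refine and_congr_right fun _ => ?_
    constructor <;> intro h <;> linarith
  · rw [direction_affineSpan]
    obtain ⟨t, ht⟩ := hne
    have hup : vectorSpan ℝ T ≤ LinearMap.ker g.toLinearMap := by
      rw [vectorSpan_def, Submodule.span_le]
      rintro _ ⟨a, ha, b, hb, rfl⟩
      have h1 := ha.2
      have h2 := hb.2
      simp only [map_sub] at h1 h2
      simp
      linarith
    have hker : Module.finrank ℝ (LinearMap.ker g.toLinearMap) = n - 1 := by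
      have h1 := LinearMap.finrank_range_add_finrank_ker g.toLinearMap
      have h2 : LinearMap.range g.toLinearMap = ⊤ := by
        apply LinearMap.range_eq_top.2
        apply LinearMap.surjective
        intro h
        have := ht.2
        have h' := LinearMap.congr_fun h (t - x₀)
        simp only [ContinuousLinearMap.coe_coe, LinearMap.zero_apply] at h'
        linarith
      rw [h2] at h1
      simp at h1
      omega
    have hlow : (⊤ : Submodule ℝ (Fin n → ℝ)) ≤ Submodule.span ℝ {t - x₀} ⊔ vectorSpan ℝ T := by
      rw [← hspan, Submodule.span_le]
      rintro _ ⟨y, hy, rfl⟩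
      have : y - x₀ = (t - x₀) + (y - t) := by abel
      simp only [this]
      exact Submodule.add_mem_sup (Submodule.mem_span_singleton_self _)
        (vsub_mem_vectorSpan ℝ hy ht)
    have h1 := Submodule.finrank_mono hlow
    have h2 := Submodule.finrank_add_le_finrank_add_finrank (Submodule.span ℝ {t - x₀})
      (vectorSpan ℝ T)
    have h3 := finrank_span_le_card (R := ℝ) ({t - x₀} : Set (Fin n → ℝ))
    have h4 := Submodule.finrank_mono hup
    simp at h1 h3
    omega

lemma s17_exists_min {V : Type*} [DecidableEq V] (K : Set (Finset V)) (σ : Finset V)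
    (h : σ ∉ K) : ∃ I ⊆ σ, IsMinimalNonface K I := by
  induction σ using Finset.strongInduction with
  | H σ ih =>
    by_cases hm : ∀ τ ⊂ σ, τ ∈ K
    · exact ⟨σ, subset_rfl, h, hm⟩
    · push Not at hm
      obtain ⟨τ, hτ, hτK⟩ := hm
      obtain ⟨I, hI, hI'⟩ := ih τ hτ hτK
      exact ⟨I, hI.trans hτ.1, hI'⟩

lemma s17_comb {m : ℕ} (K : Set (Finset (Fin m))) (hdown : ∀ σ ∈ K, ∀ τ ⊆ σ, τ ∈ K)
    (hcard : ∀ I, IsMinimalNonface K I → I.card = 4)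
    (hdisj : ∀ I I', IsMinimalNonface K I → IsMinimalNonface K I' → I ≠ I' → Disjoint I I')
    (hcover : ∀ i, ∃ I, IsMinimalNonface K I ∧ i ∈ I) :
    ∃ (N : ℕ) (e' : Fin m ≃ Fin N × Fin 4), ∀ σ : Finset (Fin m),
        σ ∈ K ↔ ∀ i : Fin N, ∃ j : Fin 4, (i, j) ∉ σ.image e' := by
  classical
  let B := {I : Finset (Fin m) // IsMinimalNonface K I}
  choose b hb hib using hcover
  let blk : Fin m → B := fun i => ⟨b i, hb i⟩
  have hblk : ∀ i (I : B), blk i = I ↔ i ∈ I.1 := by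
    intro i I
    constructor
    · rintro rfl; exact hib i
    · intro hi
      by_contra hne
      have := hdisj (b i) I.1 (hb i) I.2 (fun h => hne (Subtype.ext h))
      exact Finset.disjoint_left.1 this (hib i) hi
  have hequiv : ∀ I : B, Nonempty ({i // blk i = I} ≃ Fin 4) := by
    intro I
    apply Fintype.card_eq.1
    rw [Fintype.card_fin, ← hcard I.1 I.2, Fintype.card_subtype]
    congr 1
    ext i
    simp [hblk]
  let ψ : ∀ I : B, {i // blk i = I} ≃ Fin 4 := fun I => (hequiv I).some
  let eB : B ≃ Fin (Fintype.card B) := Fintype.equivFin B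
  let e' : Fin m ≃ Fin (Fintype.card B) × Fin 4 :=
    (Equiv.sigmaFiberEquiv blk).symm.trans ((Equiv.sigmaCongrRight ψ).trans
      ((Equiv.sigmaEquivProd B (Fin 4)).trans (Equiv.prodCongr eB (Equiv.refl _))))
  have he' : ∀ i, (e' i).1 = eB (blk i) := fun i => rfl
  refine ⟨Fintype.card B, e', fun σ => ?_⟩
  have h1 : σ ∈ K ↔ ∀ I : B, ¬ I.1 ⊆ σ := by
    constructor
    · intro h I hI
      exact I.2.1 (hdown σ h _ hI)
    · intro h
      by_contra hn
      obtain ⟨I, hI, hI'⟩ := s17_exists_min K σ hn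
      exact h ⟨I, hI'⟩ hI
  rw [h1, eB.forall_congr_left]
  refine forall_congr' fun k => ?_
  rw [Finset.not_subset]
  constructor
  · rintro ⟨i, hi, hiσ⟩
    refine ⟨(e' i).2, ?_⟩
    have : (k, (e' i).2) = e' i := by
      ext1
      · rw [he', (hblk i _).2 hi]; simp
      · rfl
    rw [this]
    simpa using hiσ
  · rintro ⟨j, hj⟩
    refine ⟨e'.symm (k, j), ?_, ?_⟩
    · rw [← hblk]
      apply eB.injective
      rw [← he']
      simp
    · intro h
      exact hj (Finset.mem_image.2 ⟨_, h, by simp⟩)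

/-- All the geometric facts on a simple polytope. -/
lemma s17_simple {n m : ℕ} {P : Set (Fin n → ℝ)} (hP : IsSimplePolytope n P)
    (e : Fin m ≃ {F : Set (Fin n → ℝ) // IsFacetOf P F}) :
    ∃ (f : Fin m → (Fin n → ℝ) →ₗ[ℝ] ℝ) (c : Fin m → ℝ), S17Rep P f c ∧
      (∀ σ, σ ∈ dualComplex P e ↔ (s17Face P f c σ).Nonempty) ∧
      (∀ σ ∈ dualComplex P e, ∀ j ∉ σ, ∃ x ∈ s17Face P f c σ, f j x ≠ c j) ∧
      (∀ i, ∃ τ ∈ dualComplex P e, insert i τ ∉ dualComplex P e) ∧ 0 < m := by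
  classical
  obtain ⟨⟨S, hS⟩, ⟨x₀, hx₀⟩, hsimple⟩ := hP
  have hx₀P : x₀ ∈ P := interior_subset hx₀
  have hn : 0 < n := by
    rcases Nat.eq_zero_or_pos n with rfl | h
    · exfalso
      have hPu : P = {x₀} := Set.Subset.antisymm (fun y _ => Subsingleton.elim _ _)
        (by simpa using hx₀P)
      have hPP : IsFaceOf P P := ⟨0, 0, by simp, by simp⟩
      have hv : IsVertexOf P x₀ := by
        unfold IsVertexOf
        rw [← hPu]; exact hPP
      have h1 := hsimple x₀ hv
      have hfin : {F : Set (Fin 0 → ℝ) | IsFacetOf P F ∧ x₀ ∈ F}.Finite := Set.toFinite _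
      rw [Set.ncard_eq_zero hfin] at h1
      have : P ∈ {F : Set (Fin 0 → ℝ) | IsFacetOf P F ∧ x₀ ∈ F} :=
        ⟨⟨hPP, ⟨x₀, hx₀P⟩,
          Module.finrank_zero_of_subsingleton⟩, hx₀P⟩
      rw [h1] at this
      exact this
    · exact h
  have hPc : IsCompact P := by
    rw [hS]; exact S.finite_toSet.isCompact_convexHull ℝ
  have hPconv : Convex ℝ P := by
    rw [hS]; exact convex_convexHull ℝ _
  choose f c hle heq using fun i => (e i).2.1
  have hstrict : ∀ i, f i x₀ < c i := by
    intro i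
    refine lt_of_le_of_ne (hle i x₀ hx₀P) fun h => ?_
    have hPF : P ⊆ (e i : Set (Fin n → ℝ)) := by
      have hf0 : ∀ y, f i y = 0 := by
        intro y
        have hev : ∀ᶠ t : ℝ in nhds 0, x₀ + t • y ∈ P ∧ x₀ - t • y ∈ P := by
          have hPn : P ∈ nhds x₀ := mem_interior_iff_mem_nhds.1 hx₀
          have t1 : Filter.Tendsto (fun t : ℝ => x₀ + t • y) (nhds 0) (nhds x₀) := by
            have : Continuous (fun t : ℝ => x₀ + t • y) := by fun_prop
            simpa using this.tendsto 0
          have t2 : Filter.Tendsto (fun t : ℝ => x₀ - t • y) (nhds 0) (nhds x₀) := by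
            have : Continuous (fun t : ℝ => x₀ - t • y) := by fun_prop
            simpa using this.tendsto 0
          exact (t1.eventually hPn).and (t2.eventually hPn)
        obtain ⟨t, ⟨h1, h2⟩, h3⟩ := ((hev.filter_mono nhdsWithin_le_nhds).and
          (self_mem_nhdsWithin (a := (0:ℝ)) (s := Set.Ioi 0))).exists
        have h1 := hle i _ h1
        have h2 := hle i _ h2
        simp only [map_add, map_sub, map_smul, h, smul_eq_mul] at h1 h2
        have h4 : t * f i y = 0 := by linarith
        rcases mul_eq_zero.1 h4 with h5 | h5
        · exact absurd h5 (ne_of_gt h3)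
        · exact h5
      intro y hy
      rw [heq i]
      refine ⟨hy, ?_⟩
      rw [hf0, ← h, hf0]
    have hdim := (e i).2.2.2
    have htop : affineSpan ℝ (e i : Set (Fin n → ℝ)) = ⊤ := by
      apply top_le_iff.1
      rw [← (isOpen_interior (s := P)).affineSpan_eq_top ⟨x₀, hx₀⟩]
      exact affineSpan_mono ℝ (interior_subset.trans hPF)
    rw [htop] at hdim
    rw [AffineSubspace.direction_top, finrank_top, Module.finrank_fin_fun] at hdim
    omega
  have hmem : ∀ x, (∀ i, f i x ≤ c i) → x ∈ P := by
    intro x hx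
    by_contra hn'
    rw [hS] at hx₀ hn'
    obtain ⟨g, h1, h2, h3⟩ := s17_violated S x₀ x hx₀ hn'
    rw [← hS] at h1 h3
    have hfac := s17_facet hn P x₀ g h1 h3
    obtain ⟨i, hi⟩ := e.surjective ⟨_, hfac⟩
    have hi' : (e i : Set (Fin n → ℝ)) = {y ∈ P | g (y - x₀) = 1} := by rw [hi]
    have hfg : f i = (c i - f i x₀) • g.toLinearMap := by
      apply LinearMap.ext_on h3
      rintro _ ⟨y, hy, rfl⟩
      have hy2 : y ∈ (e i : Set (Fin n → ℝ)) := by rw [hi']; exact hy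
      rw [heq i] at hy2
      have := hy.2
      have h5 := hy2.2
      simp only [LinearMap.smul_apply, ContinuousLinearMap.coe_coe, this]
      rw [map_sub, h5]
      simp
    have h6 := LinearMap.congr_fun hfg (x - x₀)
    simp only [LinearMap.smul_apply, ContinuousLinearMap.coe_coe, smul_eq_mul] at h6
    rw [map_sub] at h6
    have h7 : (c i - f i x₀) * 1 < (c i - f i x₀) * g (x - x₀) :=
      mul_lt_mul_of_pos_left h2 (sub_pos.2 (hstrict i))
    linarith [hx i]
  have hext : ∀ x ∈ P, ∀ w : Fin n → ℝ, (∀ i, f i x = c i → f i w ≤ 0) →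
      ∃ ε : ℝ, 0 < ε ∧ x + ε • w ∈ P := by
    intro x hx w hw
    obtain ⟨ε, he, h2⟩ := s17_eps (fun i => f i x - c i) (fun i => f i w) (by
      intro i
      rcases (hle i x hx).lt_or_eq with h | h
      · left; linarith
      · right; exact ⟨by linarith, hw i h⟩)
    refine ⟨ε, he, hmem _ fun i => ?_⟩
    have := h2 i
    simp only [map_add, map_smul, smul_eq_mul]
    linarith
  have hrep : S17Rep P f c := by
    refine ⟨hPconv, hle, ?_⟩
    intro x hx y hy h
    apply hext x hx
    intro i hi
    rw [map_sub, hi, h i hi, sub_self]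
  have hK : ∀ σ, σ ∈ dualComplex P e ↔ (s17Face P f c σ).Nonempty := by
    intro σ
    rcases σ.eq_empty_or_nonempty with rfl | ⟨i₀, hi₀⟩
    · exact iff_of_true (dualComplex_empty_mem P e) ⟨x₀, hx₀P, by simp⟩
    · have : (⋂ i ∈ σ, (e i : Set (Fin n → ℝ))) = s17Face P f c σ := by
        ext x
        simp only [Set.mem_iInter, s17Face, Set.mem_ofPred_eq]
        constructor
        · intro h
          have h' : ∀ i ∈ σ, x ∈ P ∧ f i x = c i := by
            intro i hi
            have := h i hi
            rw [heq i] at this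
            exact this
          exact ⟨(h' i₀ hi₀).1, fun i hi => (h' i hi).2⟩
        · rintro ⟨h1, h2⟩ i hi
          rw [heq i]
          exact ⟨h1, h2 i hi⟩
      change (⋂ i ∈ σ, (e i : Set (Fin n → ℝ))).Nonempty ↔ _
      rw [this]
  have hvert : ∀ σ, (s17Face P f c σ).Nonempty → ∃ v ∈ s17Face P f c σ, IsVertexOf P v ∧
      ∀ y ∈ P, (∀ i, f i v = c i → f i y = c i) → y = v := by
    intro σ hne
    have hcomp : IsCompact (s17Face P f c σ) := by
      have : s17Face P f c σ = P ∩ ⋂ i ∈ σ, {x | f i x = c i} := by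
        ext x; simp [s17Face]
      rw [this]
      refine hPc.inter_right (isClosed_biInter fun i _ => isClosed_eq ?_ continuous_const)
      exact LinearMap.continuous_of_finiteDimensional (f i)
    obtain ⟨v, hv⟩ := hcomp.extremePoints_nonempty hne
    have hvσ : v ∈ s17Face P f c σ := extremePoints_subset hv
    have hun : ∀ y ∈ P, (∀ i, f i v = c i → f i y = c i) → y = v := by
      intro y hy h
      obtain ⟨ε, he, h2⟩ := hrep.ext v hvσ.1 y hy h
      have hyσ : y ∈ s17Face P f c σ := ⟨hy, fun i hi => h i (hvσ.2 i hi)⟩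
      have hzσ : v + ε • (v - y) ∈ s17Face P f c σ := ⟨h2, fun i hi => by
        simp [hvσ.2 i hi, hyσ.2 i hi]⟩
      refine ((mem_extremePoints.1 hv).2 _ hyσ _ hzσ ?_).1
      refine ⟨ε / (1 + ε), 1 / (1 + ε), by positivity, by positivity, by field_simp; ring, ?_⟩
      ext k
      simp
      field_simp
      ring
    refine ⟨v, hvσ, ?_, hun⟩
    have : {v} = s17Face P f c (Finset.univ.filter fun i => f i v = c i) := by
      ext y
      simp only [Set.mem_singleton_iff, s17Face, Set.mem_ofPred_eq, Finset.mem_filter,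
        Finset.mem_univ, true_and]
      constructor
      · rintro rfl; exact ⟨hvσ.1, fun _ h => h⟩
      · rintro ⟨h1, h2⟩; exact hun y h1 h2
    unfold IsVertexOf
    rw [this]
    exact s17Face_isFace hrep _
  have hcount : ∀ v, v ∈ P → IsVertexOf P v → Fintype.card {i // f i v = c i} = n := by
    intro v hvP hv
    have h1 := hsimple v hv
    have : {F | IsFacetOf P F ∧ v ∈ F} =
        (fun i => (e i : Set (Fin n → ℝ))) '' {i | f i v = c i} := by
      ext F
      constructor
      · rintro ⟨hF, hvF⟩
        obtain ⟨i, hi⟩ := e.surjective ⟨F, hF⟩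
        have hi' : (e i : Set (Fin n → ℝ)) = F := by rw [hi]
        refine ⟨i, ?_, hi'⟩
        rw [← hi', heq i] at hvF
        exact hvF.2
      · rintro ⟨i, hi, rfl⟩
        refine ⟨(e i).2, ?_⟩
        have : v ∈ {x ∈ P | f i x = c i} := ⟨hvP, hi⟩
        rw [← heq i] at this
        exact this
    have hin : Function.Injective (fun i => (e i : Set (Fin n → ℝ))) :=
      Subtype.val_injective.comp e.injective
    rw [this, Set.ncard_image_of_injective _ hin] at h1
    refine Eq.trans ?_ h1
    rw [← Nat.card_eq_fintype_card]
    rfl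
  refine ⟨f, c, hrep, hK, ?_, ?_, ?_⟩
  · intro σ hσ j hj
    obtain ⟨v, hvσ, hv, hun⟩ := hvert σ ((hK σ).1 hσ)
    by_cases hjv : f j v = c j
    swap
    · exact ⟨v, hvσ, hjv⟩
    let L : (Fin n → ℝ) →ₗ[ℝ] ({i // f i v = c i} → ℝ) := LinearMap.pi fun i => f i.1
    have hLinj : Function.Injective L := by
      rw [injective_iff_map_eq_zero]
      intro w hw
      have hw' : ∀ i, f i v = c i → f i w = 0 := fun i hi => congrFun hw ⟨i, hi⟩
      obtain ⟨ε, he, h2⟩ := hext v hvσ.1 w (fun i hi => (hw' i hi).le)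
      have := hun _ h2 (fun i hi => by simp [hi, hw' i hi])
      have h3 : ε • w = 0 := by simpa using this
      exact (smul_eq_zero.1 h3).resolve_left he.ne'
    have hLsurj : Function.Surjective L := by
      refine (LinearMap.injective_iff_surjective_of_finrank_eq_finrank ?_).1 hLinj
      simp only [Module.finrank_fintype_fun_eq_card, Fintype.card_fin]
      exact (hcount v hvσ.1 hv).symm
    obtain ⟨w, hw⟩ := hLsurj (Pi.single ⟨j, hjv⟩ (-1))
    have hw1 : f j w = -1 := by
      have := congrFun hw ⟨j, hjv⟩
      simpa [L] using this
    have hw2 : ∀ i, f i v = c i → i ≠ j → f i w = 0 := by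
      intro i hi hij
      have := congrFun hw ⟨i, hi⟩
      rw [Pi.single_eq_of_ne (fun h => hij (congrArg Subtype.val h))] at this
      exact this
    obtain ⟨ε, he, h2⟩ := hext v hvσ.1 w (fun i hi => by
      by_cases hij : i = j
      · rw [hij, hw1]; norm_num
      · exact (hw2 i hi hij).le)
    refine ⟨_, ⟨h2, fun i hi => ?_⟩, ?_⟩
    · have hij : i ≠ j := by rintro rfl; exact hj hi
      simp [hvσ.2 i hi, hw2 i (hvσ.2 i hi) hij]
    · simp [hjv, hw1, he.ne']
  · intro i
    obtain ⟨y, hy, hmin⟩ := hPc.exists_isMinOn ⟨x₀, hx₀P⟩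
      (LinearMap.continuous_of_finiteDimensional (f i)).continuousOn
    have hface : IsFaceOf P {x ∈ P | f i x = f i y} := by
      refine ⟨-f i, -f i y, fun x hx => ?_, ?_⟩
      · have := hmin hx
        simpa using this
      · ext x; simp
    obtain ⟨τ, hτ⟩ := s17_exists_face hrep _ hface ⟨y, hy, rfl⟩
    have hyτ : y ∈ s17Face P f c τ := by rw [← hτ]; exact ⟨hy, rfl⟩
    refine ⟨τ, (hK τ).2 ⟨y, hyτ⟩, fun hins => ?_⟩
    obtain ⟨z, hz, hz2⟩ := (hK _).1 hins
    have hzτ : z ∈ s17Face P f c τ := ⟨hz, fun k hk => hz2 k (Finset.mem_insert_of_mem hk)⟩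
    rw [← hτ] at hzτ
    have h1 := hzτ.2
    have h2 := hz2 i (Finset.mem_insert_self _ _)
    have h3 : f i y ≤ f i x₀ := hmin hx₀P
    have h4 := hstrict i
    linarith
  · obtain ⟨v, hvσ, hv, hun⟩ := hvert ∅ ⟨x₀, hx₀P, by simp⟩
    have h1 := hcount v hvσ.1 hv
    have : 0 < Fintype.card {i // f i v = c i} := by omega
    obtain ⟨i⟩ := Fintype.card_pos_iff.1 this
    exact lt_of_le_of_lt (Nat.zero_le _) i.1.2

/- STATEMENT 17: Let P be a simple polytope such that all minimal nonfaces of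
K(P) have cardinality 4 and are pairwise disjoint, and K(P) is a simplicial
sphere.  Then K(P) = ∂Δ³ ⋆ ⋯ ⋆ ∂Δ³ (N-fold join) for some N — i.e. the facets
of P can be relabelled by `Fin N × Fin 4` so that a set of facets has a common
point iff it omits a facet from each block — and hence P = (Δ³)^N, i.e. P is
combinatorially equivalent to (Δ³)^N (its face poset is isomorphic to that of
(Δ³)^N). -/
theorem stmt17 (n m : ℕ) (P : Set (Fin n → ℝ)) (hP : IsSimplePolytope n P)
    (e : Fin m ≃ {F : Set (Fin n → ℝ) // IsFacetOf P F})
    (hcard : ∀ I, IsMinimalNonface (dualComplex P e) I → I.card = 4)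
    (hdisj : ∀ I I', IsMinimalNonface (dualComplex P e) I →
      IsMinimalNonface (dualComplex P e) I' → I ≠ I' → Disjoint I I')
    (hsphere : Nonempty
      (↥(realization (dualComplex P e)) ≃ₜ
        ↥(Metric.sphere (0 : EuclideanSpace ℝ (Fin n)) 1))) :
    ∃ (N : ℕ) (e' : Fin m ≃ Fin N × Fin 4),
      (∀ σ : Finset (Fin m),
        σ ∈ dualComplex P e ↔ ∀ i : Fin N, ∃ j : Fin 4, (i, j) ∉ σ.image e') ∧
      Nonempty
        ({F : Set (Fin n → ℝ) // IsFaceOf P F} ≃o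
          {F : Set (Fin N × Fin 4 → ℝ) // IsFaceOf (prodDelta3 N) F}) := by
  classical
  obtain ⟨f, c, hrep, hK, hinj, hcov, hm⟩ := s17_simple hP e
  have hdown : ∀ σ ∈ dualComplex P e, ∀ τ ⊆ σ, τ ∈ dualComplex P e := by
    intro σ hσ τ hτ
    rw [hK] at hσ ⊢
    obtain ⟨x, hx, hx2⟩ := hσ
    exact ⟨x, hx, fun i hi => hx2 i (hτ hi)⟩
  have hcover : ∀ i, ∃ I, IsMinimalNonface (dualComplex P e) I ∧ i ∈ I := by
    intro i
    obtain ⟨τ, hτ, hins⟩ := hcov i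
    obtain ⟨I, hI, hI'⟩ := s17_exists_min _ _ hins
    refine ⟨I, hI', ?_⟩
    by_contra hi
    exact hI'.1 (hdown τ hτ I ((Finset.subset_insert_iff_of_notMem hi).1 hI))
  obtain ⟨N, e', he'⟩ := s17_comb (dualComplex P e) hdown hcard hdisj hcover
  refine ⟨N, e', he', ?_⟩
  have hN : 0 < N := lt_of_le_of_lt (Nat.zero_le _) (e' ⟨0, hm⟩).1.2
  have huniv : Finset.univ ∉ dualComplex P e := by
    intro h
    obtain ⟨I, hI, -⟩ := hcover ⟨0, hm⟩
    exact hI.1 (hdown _ h I (Finset.subset_univ I))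
  obtain ⟨A⟩ := s17_orderIso hrep (dualComplex P e) hK huniv hinj
  let K' : Set (Finset (Fin N × Fin 4)) := {τ | ∀ i : Fin N, ∃ j : Fin 4, (i, j) ∉ τ}
  obtain ⟨B⟩ := s17_prod_iso N hN K' (fun _ => Iff.rfl)
  let C : {σ : Finset (Fin m) // σ ∈ dualComplex P e ∨ σ = Finset.univ} ≃o
      {σ : Finset (Fin N × Fin 4) // σ ∈ K' ∨ σ = Finset.univ} :=
    { toEquiv := Equiv.subtypeEquiv e'.finsetCongr (by
        intro σ
        have h1 : e'.finsetCongr σ = σ.image e' := by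
          rw [Equiv.finsetCongr_apply, Finset.map_eq_image]; rfl
        have h2 : σ = Finset.univ ↔ e'.finsetCongr σ = Finset.univ := by
          have : e'.finsetCongr Finset.univ = Finset.univ := by simp
          rw [← this, e'.finsetCongr.injective.eq_iff]
        rw [← h2, h1, he']
        rfl)
      map_rel_iff' := by
        intro a b
        exact Finset.map_subset_map }
  exact ⟨A.trans (C.dual.trans B.symm)⟩
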